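/- Let G = (V, E) be a finite directed graph and B ⊆ V a fixed subset. Let L(G, B) be the collection of subsets X ⊆ V such that there exists Y ⊆ B and a family of pairwise vertex-disjoint directed paths linking X onto Y (one path from each vertex of X, with the terminal vertices exactly Y, under some bijection X → Y). Then L(G, B) is the collection of independent sets of a matroid on V. -/

import Mathlib

/-- `Linked Adj B X` : the vertex set `X` can be linked into `B` in the directed graph with
adjacency `Adj`, i.e. there is a family of pairwise vertex-disjoint directed paths, one starting
at each vertex of `X`, all terminating in `B` (the terminal vertices form a subset `Y ⊆ B`, in
bijection with `X` via the paths). -/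
def Linked {V : Type*} (Adj : V → V → Prop) (B : Set V) (X : Set V) : Prop :=
  ∃ P : X → List V,
    (∀ x : X, (P x).Chain' Adj ∧ (P x).Nodup ∧ (P x).head? = some x.1 ∧
      ∃ y ∈ B, (P x).getLast? = some y) ∧
    ∀ x x' : X, x ≠ x' → ∀ v ∈ P x, v ∉ P x'

open Relation in
/-- Along a relation with unique predecessors, an element is reachable from at most one
element without predecessors. -/
lemma Relator.LeftUnique.eq_of_reflTransGen {α : Type*} {r : α → α → Prop}
    (hr : Relator.LeftUnique r) {x y v : α} (hx : ∀ u, ¬ r u x) (hy : ∀ u, ¬ r u y)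
    (hxv : ReflTransGen r x v) (hyv : ReflTransGen r y v) : x = y := by
  induction hxv generalizing y with
  | refl =>
    rcases hyv.cases_tail with h | ⟨c, -, hc⟩
    · exact h
    · exact absurd hc (hx c)
  | tail _ hbc ih =>
    rcases hyv.cases_tail with h | ⟨c, hyc, hc⟩
    · exact absurd (h ▸ hbc) (hy _)
    · exact ih hy (hr hc hbc ▸ hyc)

open Relation in
/-- Along a relation with unique predecessors, no cycle is reachable from an element without
predecessors. -/
lemma Relator.LeftUnique.not_transGen_self {α : Type*} {r : α → α → Prop}
    (hr : Relator.LeftUnique r) {x v : α} (hx : ∀ u, ¬ r u x)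
    (hxv : ReflTransGen r x v) : ¬ TransGen r v v := by
  induction hxv with
  | refl =>
    intro h
    obtain ⟨c, -, hc⟩ := TransGen.tail'_iff.1 h
    exact hx c hc
  | tail _ hbc ih =>
    intro h
    obtain ⟨d, hcd, hd⟩ := TransGen.tail'_iff.1 h
    exact ih (TransGen.head' hbc (hr hd hbc ▸ hcd))

/-- `IsShift Adj B X f` : outside `B`, the map `f` is injective, avoids `X`, and either fixes a
vertex or moves it along an edge. -/
structure IsShift {V : Type*} (Adj : V → V → Prop) (B X : Set V) (f : V → V) : Prop where
  injOn : Set.InjOn f Bᶜ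
  notMem : ∀ v ∉ B, f v ∉ X
  eq_or_adj : ∀ v ∉ B, f v = v ∨ Adj v (f v)

open Relation in
lemma IsShift.linked {V : Type*} [Finite V] {Adj : V → V → Prop} {B X : Set V} {f : V → V}
    (hf : IsShift Adj B X f) : Linked Adj B X := by
  let r : V → V → Prop := fun u v ↦ u ∉ B ∧ f u = v ∧ Adj u v
  have hr : Relator.LeftUnique r := fun a b c ha hb ↦
    hf.injOn ha.1 hb.1 (ha.2.1.trans hb.2.1.symm)
  have hroot : ∀ x ∈ X, ∀ u, ¬ r u x := fun x hx u hu ↦ hf.notMem u hu.1 (hu.2.1 ▸ hx)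
  have hend : ∀ x ∈ X, ∃ y ∈ B, ReflTransGen r x y := by
    intro x hx
    by_contra! hB
    have hout : ∀ u, ReflTransGen r x u → u ∉ B := fun u hu hu' ↦ hB u hu' hu
    have hmaps : Set.MapsTo f {u | ReflTransGen r x u} {u | ReflTransGen r x u} := by
      intro u hu
      rcases hf.eq_or_adj u (hout u hu) with h | h
      · rwa [h]
      · exact ReflTransGen.tail hu ⟨hout u hu, rfl, h⟩
    obtain ⟨u, hu, hux⟩ := (((Set.toFinite _).injOn_iff_bijOn_of_mapsTo hmaps).1
      (hf.injOn.mono hout)).surjOn (ReflTransGen.refl : ReflTransGen r x x)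
    exact hf.notMem u (hout u hu) (hux ▸ hx)
  have hpath : ∀ x : X, ∃ l : List V, l.IsChain r ∧ l.head? = some x.1 ∧
      ∃ y ∈ B, l.getLast? = some y := by
    rintro ⟨x, hx⟩
    obtain ⟨y, hy, hxy⟩ := hend x hx
    obtain ⟨l, hl, hly⟩ := List.exists_isChain_cons_of_relationReflTransGen hxy
    exact ⟨x :: l, hl, rfl, y, hy, by rw [List.getLast?_eq_getLast_of_ne_nil (by simp), hly]⟩
  choose P hchain hhead hlast using hpath
  have hpair : ∀ x, (P x).Pairwise (TransGen r) := fun x ↦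
    List.isChain_iff_pairwise.1 ((hchain x).imp fun _ _ ↦ TransGen.single)
  have hreach : ∀ x : X, ∀ v ∈ P x, ReflTransGen r x v := by
    intro x v hv
    obtain ⟨t, ht⟩ := List.head?_eq_some_iff.1 (hhead x)
    have hp := hpair x
    rw [ht] at hv hp
    rcases List.mem_cons.1 hv with rfl | hv
    · exact .refl
    · exact (List.rel_of_pairwise_cons hp hv).to_reflTransGen
  refine ⟨P, fun x ↦ ⟨(hchain x).imp fun _ _ h ↦ h.2.2, ?_, hhead x, hlast x⟩, ?_⟩
  · refine (hpair x).imp_of_mem fun {a b} ha _ hab h ↦ ?_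
    exact hr.not_transGen_self (hroot x x.2) (hreach x a ha) (h ▸ hab)
  · intro x x' hne v hv hv'
    exact hne (Subtype.ext (hr.eq_of_reflTransGen (hroot x x.2) (hroot x' x'.2)
      (hreach x v hv) (hreach x' v hv')))

lemma Linked.exists_isShift {V : Type*} {Adj : V → V → Prop} {B X : Set V}
    (h : Linked Adj B X) : ∃ f, IsShift Adj B X f := by
  obtain ⟨P, hP, hdisj⟩ := h
  have hsame : ∀ {x x' v}, v ∈ P x → v ∈ P x' → x = x' := fun {x x' v} hv hv' ↦ by
    by_contra hne
    exact hdisj x x' hne v hv hv'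
  have hself : ∀ x, x.1 ∈ P x := fun x ↦ List.mem_of_head? (hP x).2.2.1
  have hnext : ∀ v, ∃ u, v ∉ B →
      (∃ x l₁ l₂, P x = l₁ ++ v :: u :: l₂) ∨ (u = v ∧ ∀ x, v ∉ P x) := by
    intro v
    by_cases hv : ∃ x, v ∈ P x
    · obtain ⟨x, hx⟩ := hv
      obtain ⟨l₁, t, ht⟩ := List.append_of_mem hx
      cases t with
      | nil =>
        obtain ⟨y, hy, hlast⟩ := (hP x).2.2.2
        refine ⟨v, fun hvB ↦ absurd ?_ hvB⟩
        simp only [ht, List.getLast?_append, List.getLast?_singleton, Option.some_or,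
          Option.some.injEq] at hlast
        rwa [hlast]
      | cons u l₂ => exact ⟨u, fun _ ↦ .inl ⟨x, l₁, l₂, ht⟩⟩
    · push Not at hv
      exact ⟨v, fun _ ↦ .inr ⟨rfl, hv⟩⟩
  choose f hf using hnext
  refine ⟨f, fun v hv w hw hvw ↦ ?_, fun v hv hvX ↦ ?_, fun v hv ↦ ?_⟩
  · rcases hf v hv with ⟨x, l₁, l₂, hx⟩ | ⟨hfv, hvP⟩ <;>
      rcases hf w hw with ⟨x', l₁', l₂', hx'⟩ | ⟨hfw, hwP⟩
    · obtain rfl : x = x' := hsame (v := f v) (by simp [hx]) (by simp [hx', hvw])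
      have hnodup := (hP x).2.1
      have heq : (l₁ ++ [v]) ++ f v :: l₂ = (l₁' ++ [w]) ++ f v :: l₂' := by
        rw [hvw] at hx ⊢
        simpa [hx] using hx'
      have hn : ((l₁ ++ [v]) ++ f v :: l₂).Nodup := by simpa [hx] using hnodup
      have hn' := List.nodup_append.1 hn
      have hpre : l₁ ++ [v] = l₁' ++ [w] := ((List.append_cons_inj_of_notMem
        (fun hm ↦ hn'.2.2 _ hm _ (by simp) rfl) (List.nodup_cons.1 hn'.2.1).1).1 heq).1
      simpa using congrArg List.getLast? hpre
    · exact absurd (by simp [hx, hvw, hfw]) (hwP x)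
    · exact absurd (by simp [hx', ← hvw, hfv]) (hvP x')
    · rw [← hfv, hvw, hfw]
  · rcases hf v hv with ⟨x, l₁, l₂, hx⟩ | ⟨hfv, hvP⟩
    · obtain rfl : x = ⟨f v, hvX⟩ := hsame (v := f v) (by simp [hx]) (hself ⟨f v, hvX⟩)
      obtain ⟨-, hnodup, hhead, -⟩ := hP ⟨f v, hvX⟩
      rw [hx] at hnodup hhead
      cases l₁ <;> simp_all
    · rw [hfv] at hvX
      exact hvP _ (hself ⟨v, hvX⟩)
  · rcases hf v hv with ⟨x, l₁, l₂, hx⟩ | ⟨hfv, -⟩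
    · have hc : (P x).IsChain Adj := (hP x).1
      rw [hx] at hc
      exact .inr (List.isChain_append.1 hc).2.1.rel
    · exact .inl hfv

open Relation in
lemma IsShift.exists_insert {V : Type*} [DecidableEq V] {Adj : V → V → Prop} {B : Set V}
    {I₁ I₂ : Finset V} {f₁ f₂ : V → V} (h₁ : IsShift Adj B I₁ f₁) (h₂ : IsShift Adj B I₂ f₂)
    (hcard : I₁.card < I₂.card) :
    ∃ e ∈ I₂ \ I₁, ∃ f, IsShift Adj B ↑(insert e I₁) f := by
  classical
  by_contra! hno
  let r : V → V → Prop := fun u v ↦ ∃ w ∉ B, f₁ w = u ∧ f₂ w = v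
  have hr : Relator.LeftUnique r := by
    rintro a b c ⟨w, hw, rfl, rfl⟩ ⟨w', hw', rfl, hww'⟩
    rw [h₂.injOn hw' hw hww']
  have hroot : ∀ e ∈ I₂ \ I₁, ∀ u, ¬ r u e := by
    rintro e he u ⟨w, hw, -, rfl⟩
    exact h₂.notMem w hw (Finset.mem_sdiff.1 he).1
  have hend : ∀ e ∈ I₂ \ I₁, ∃ t ∈ I₁ \ I₂, ReflTransGen r e t := by
    intro e he
    by_contra! hbad
    refine hno e he (fun w ↦ if ReflTransGen r e (f₁ w) then f₂ w else f₁ w)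
      ⟨fun v hv w hw hvw ↦ ?_, fun v hv ↦ ?_, fun v hv ↦ ?_⟩
    · split_ifs at hvw with hev hew hew
      · exact h₂.injOn hv hw hvw
      · exact absurd (hev.tail ⟨v, hv, rfl, hvw⟩) hew
      · exact absurd (hew.tail ⟨w, hw, rfl, hvw.symm⟩) hev
      · exact h₁.injOn hv hw hvw
    · have hv₁ : f₁ v ∉ I₁ := h₁.notMem v hv
      have hv₂ : f₂ v ∉ I₂ := h₂.notMem v hv
      simp only [Finset.coe_insert, Set.mem_insert_iff, Finset.mem_coe, not_or]
      split_ifs with hev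
      · exact ⟨fun h ↦ hv₂ (h ▸ (Finset.mem_sdiff.1 he).1), fun h ↦
          hbad _ (Finset.mem_sdiff.2 ⟨h, hv₂⟩) (hev.tail ⟨v, hv, rfl, rfl⟩)⟩
      · exact ⟨fun h ↦ hev (h ▸ .refl), hv₁⟩
    · split_ifs
      · exact h₂.eq_or_adj v hv
      · exact h₁.eq_or_adj v hv
  choose! t ht het using hend
  have hle : (I₂ \ I₁).card ≤ (I₁ \ I₂).card :=
    Finset.card_le_card_of_injOn t ht fun e he e' he' h ↦
      hr.eq_of_reflTransGen (hroot e he) (hroot e' he') (het e he) (h ▸ het e' he')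
  exact absurd (Finset.card_sdiff_lt_card_sdiff_iff.2 hcard) hle.not_gt

/-- For a finite directed graph `G = (V, E)` and a fixed `B ⊆ V`, the collection
`L(G, B)` of subsets of `V` linkable onto a subset of `B` by pairwise vertex-disjoint directed
paths is the collection of independent sets of a matroid on `V` (a strict gammoid). -/
theorem stmt5 {V : Type*} [Fintype V] [DecidableEq V] (Adj : V → V → Prop) (B : Finset V) :
    (Linked Adj ↑B (↑(∅ : Finset V) : Set V)) ∧
    (∀ I I' : Finset V, Linked Adj ↑B ↑I → I' ⊆ I → Linked Adj ↑B ↑I') ∧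
    (∀ I₁ I₂ : Finset V, Linked Adj ↑B ↑I₁ → Linked Adj ↑B ↑I₂ →
      I₁.card < I₂.card → ∃ e ∈ I₂ \ I₁, Linked Adj ↑B ↑(insert e I₁)) := by
  refine ⟨⟨fun x ↦ absurd x.2 (by simp), fun x ↦ absurd x.2 (by simp),
    fun x ↦ absurd x.2 (by simp)⟩, ?_, ?_⟩
  · rintro I I' ⟨P, hP, hdisj⟩ hI
    exact ⟨fun x ↦ P ⟨x, hI x.2⟩, fun x ↦ hP ⟨x, hI x.2⟩, fun x x' hne ↦
      hdisj _ _ fun h ↦ hne (Subtype.ext (Subtype.mk.inj h))⟩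
  · intro I₁ I₂ hI₁ hI₂ hcard
    obtain ⟨f₁, hf₁⟩ := hI₁.exists_isShift
    obtain ⟨f₂, hf₂⟩ := hI₂.exists_isShift
    obtain ⟨e, he, f, hf⟩ := hf₁.exists_insert hf₂ hcard
    exact ⟨e, he, hf.linked⟩
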